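/- If x and z are commuting Artin–Schreier elements of A with x ∉ F·1 and z not contained in the F-subalgebra F[x] generated by x, then there exist square-central elements y, u ∈ A such that (x, y, z, u) is a quadruple of generators of A. -/

import Mathlib

/-- `x` is an Artin–Schreier element: `x² + x ∈ F·1`. -/
def IsArtinSchreier (F : Type*) {A : Type*} [Field F] [Ring A] [Algebra F A] (x : A) : Prop :=
  x ^ 2 + x ∈ Set.range (algebraMap F A)

/-- `y` is a square-central element: `y² ∈ F·1`. -/
def IsSquareCentral (F : Type*) {A : Type*} [Field F] [Ring A] [Algebra F A] (y : A) : Prop :=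
  y ^ 2 ∈ Set.range (algebraMap F A)

/-- `(x, y, z, u)` is a quadruple of generators of the biquaternion algebra `A`. -/
def IsQuadruple (F : Type*) {A : Type*} [Field F] [Ring A] [Algebra F A]
    (q : A × A × A × A) : Prop :=
  match q with
  | (x, y, z, u) =>
    y ≠ 0 ∧ u ≠ 0 ∧
    IsArtinSchreier F x ∧ IsSquareCentral F y ∧
    IsArtinSchreier F z ∧ IsSquareCentral F u ∧
    x * y + y * x = y ∧ x * z = z * x ∧ x * u = u * x ∧
    y * z = z * y ∧ y * u = u * y ∧ z * u + u * z = u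

section Twist

variable {F A : Type*} [Field F] [DivisionRing A] [Algebra F A]

/-- The elements `a` with `x' a = a x + i a`. -/
def twist (x' x : A) (i : F) : Submodule F A where
  carrier := {a | x' * a = a * x + i • a}
  add_mem' := by
    intro a b ha hb
    simp only [Set.mem_ofPred_eq] at *
    rw [mul_add, ha, hb, add_mul, smul_add]
    abel
  zero_mem' := by simp
  smul_mem' := by
    intro c a ha
    simp only [Set.mem_ofPred_eq] at *
    rw [mul_smul_comm, ha, smul_add, smul_mul_assoc, smul_comm]

theorem mem_twist {x' x a : A} {i : F} : a ∈ twist x' x i ↔ x' * a = a * x + i • a := Iff.rfl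

theorem mem_twist_zero {x' x a : A} : a ∈ twist x' x (0 : F) ↔ x' * a = a * x := by
  simp [mem_twist]

theorem mem_twist_one {x' x a : A} : a ∈ twist x' x (1 : F) ↔ x' * a = a * x + a := by
  simp [mem_twist]

theorem mul_mem_twist {x'' x' x a b : A} {i j : F} (ha : a ∈ twist x'' x' i)
    (hb : b ∈ twist x' x j) : a * b ∈ twist x'' x (i + j) := by
  rw [mem_twist] at *
  rw [← mul_assoc, ha, add_mul, mul_assoc, hb, mul_add, mul_assoc, smul_mul_assoc,
    mul_smul_comm, add_smul]
  abel

theorem inv_mem_twist [CharP A 2] {x' x a : A} {i : F} (ha : a ∈ twist x' x i) :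
    a⁻¹ ∈ twist x x' i := by
  rcases eq_or_ne a 0 with rfl | h
  · simp
  rw [mem_twist] at *
  have h1 : a⁻¹ * x' = x * a⁻¹ + i • a⁻¹ := by
    have := congrArg (fun t => a⁻¹ * t * a⁻¹) ha
    simpa [mul_assoc, mul_add, add_mul, h] using this
  rw [h1, add_assoc, CharTwo.add_self_eq_zero, add_zero]

theorem exists_twist_decomposition [CharP A 2] {x' x z' z α β : A}
    (hx' : x' ^ 2 + x' = α) (hx : x ^ 2 + x = α) (hz' : z' ^ 2 + z' = β) (hz : z ^ 2 + z = β)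
    (hα : ∀ a, α * a = a * α) (hβ : ∀ a, β * a = a * β)
    (h' : x' * z' = z' * x') (h : x * z = z * x) (a : A) :
    ∃ b c d e : A,
      b ∈ twist x' x (0 : F) ⊓ twist z' z (0 : F) ∧ c ∈ twist x' x (1 : F) ⊓ twist z' z (0 : F) ∧
      d ∈ twist x' x (0 : F) ⊓ twist z' z (1 : F) ∧ e ∈ twist x' x (1 : F) ⊓ twist z' z (1 : F) ∧
      a = b + c + d + e := by
  have key : ∀ {s' s γ : A}, s' ^ 2 + s' = γ → s ^ 2 + s = γ → (∀ a, γ * a = a * γ) → ∀ a,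
      s' * (s' * a + a * s) = (s' * a + a * s) * s + (s' * a + a * s) := by
    intro s' s γ h1 h2 h3 a
    have h4 : (s' ^ 2 + s') * a = a * (s ^ 2 + s) := by rw [h1, h2, h3]
    have h5 : s' * (s' * a) = a * s * s + a * s + s' * a := by
      rw [← CharTwo.sub_eq_add (a * s * s + a * s), eq_sub_iff_add_eq]
      simpa only [pow_two, add_mul, mul_add, mul_assoc] using h4
    rw [mul_add, h5]
    noncomm_ring
  have hX := fun a => key hx' hx hα a
  have hZ := fun a => key hz' hz hβ a
  have comm : ∀ a, z' * (x' * a + a * x) + (x' * a + a * x) * z =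
      x' * (z' * a + a * z) + (z' * a + a * z) * x := by
    intro a
    simp only [mul_add, add_mul, ← mul_assoc, h']
    simp only [mul_assoc, h]
    abel
  set D : A → A := fun a => x' * a + a * x with hD
  set E : A → A := fun a => z' * a + a * z with hE
  have hD' : ∀ a, x' * a = a * x + D a := fun a => by grind
  have hE' : ∀ a, z' * a = a * z + E a := fun a => by grind
  have hDD : ∀ a, D (D a) = D a := fun a => by have := hX a; grind
  have hEE : ∀ a, E (E a) = E a := fun a => by have := hZ a; grind
  have hDE : ∀ a, E (D a) = D (E a) := comm
  have hDa : ∀ a b, D (a + b) = D a + D b := fun a b => by simp only [hD]; noncomm_ring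
  have hEa : ∀ a b, E (a + b) = E a + E b := fun a b => by simp only [hE]; noncomm_ring
  have m0 : ∀ a, D a = 0 → a ∈ twist x' x (0 : F) := fun a h => by
    rw [mem_twist_zero, hD', h, add_zero]
  have m1 : ∀ a, D a = a → a ∈ twist x' x (1 : F) := fun a h => by
    rw [mem_twist_one, hD', h]
  have n0 : ∀ a, E a = 0 → a ∈ twist z' z (0 : F) := fun a h => by
    rw [mem_twist_zero, hE', h, add_zero]
  have n1 : ∀ a, E a = a → a ∈ twist z' z (1 : F) := fun a h => by
    rw [mem_twist_one, hE', h]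
  clear_value D E
  refine ⟨a + D a + E a + D (E a), D a + D (E a), E a + D (E a), D (E a),
    ⟨m0 _ ?_, n0 _ ?_⟩, ⟨m1 _ ?_, n0 _ ?_⟩, ⟨m0 _ ?_, n1 _ ?_⟩, ⟨m1 _ ?_, n1 _ ?_⟩, ?_⟩ <;>
  (try simp only [hDa, hEa, hDD, hEE, hDE]) <;> grind


/-- If `x` and `z` are independent commuting Artin–Schreier elements, all four pieces
are nonzero. -/
theorem exists_ne_zero_mem_twist [CharP A 2] (hcentral : Subalgebra.center F A = ⊥)
    {x z : A} (hx : IsArtinSchreier F x) (hz : IsArtinSchreier F z) (hcomm : x * z = z * x)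
    (hx' : x ∉ Set.range (algebraMap F A)) (hz' : z ∉ Algebra.adjoin F ({x} : Set A)) :
    ∃ y u w : A, y ≠ 0 ∧ u ≠ 0 ∧ w ≠ 0 ∧
      y ∈ twist x x (1 : F) ⊓ twist z z (0 : F) ∧ u ∈ twist x x (0 : F) ⊓ twist z z (1 : F) ∧
      w ∈ twist x x (1 : F) ⊓ twist z z (1 : F) := by
  obtain ⟨α, hα⟩ := hx
  obtain ⟨β, hβ⟩ := hz
  have dec := exists_twist_decomposition (F := F) (A := A) hα.symm hα.symm hβ.symm hβ.symm
    (fun a => Algebra.commutes α a) (fun a => Algebra.commutes β a) hcomm hcomm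
  have cen : ∀ t : A, (∀ a, t * a = a * t) → t ∈ Set.range (algebraMap F A) := fun t ht => by
    have : t ∈ Subalgebra.center F A := Subalgebra.mem_center_iff.2 fun b => (ht b).symm
    rw [hcentral] at this
    exact Algebra.mem_bot.1 this
  have hzF : z ∉ Set.range (algebraMap F A) := by
    rintro ⟨c, rfl⟩
    exact hz' (Subalgebra.algebraMap_mem _ c)
  have hxzF : x + z ∉ Set.range (algebraMap F A) := by
    rintro ⟨c, hc⟩
    refine hz' ?_
    have : z = algebraMap F A c - x := by rw [hc]; abel
    rw [this]
    exact sub_mem (Subalgebra.algebraMap_mem _ c) (Algebra.self_mem_adjoin_singleton F x)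
  have two : (1 : F) + 1 = 0 := by
    have : (algebraMap F A) (1 + 1) = 0 := by
      rw [map_add, map_one, CharTwo.add_self_eq_zero]
    exact (map_eq_zero _).1 this
  set Y := twist x x (1 : F) ⊓ twist z z (0 : F) with hY
  set U := twist x x (0 : F) ⊓ twist z z (1 : F) with hU
  set W := twist x x (1 : F) ⊓ twist z z (1 : F) with hW
  have hYUW : ∀ y ∈ Y, ∀ u ∈ U, y * u ∈ W := fun y hy u hu => by
    have h1 := mul_mem_twist hy.1 hu.1
    have h2 := mul_mem_twist hy.2 hu.2
    rw [add_zero] at h1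
    rw [zero_add] at h2
    exact ⟨h1, h2⟩
  have hYWU : ∀ y ∈ Y, ∀ u ∈ W, y * u ∈ U := fun y hy u hu => by
    have h1 := mul_mem_twist hy.1 hu.1
    have h2 := mul_mem_twist hy.2 hu.2
    rw [two] at h1
    rw [zero_add] at h2
    exact ⟨h1, h2⟩
  have hUWY : ∀ y ∈ U, ∀ u ∈ W, y * u ∈ Y := fun y hy u hu => by
    have h1 := mul_mem_twist hy.1 hu.1
    have h2 := mul_mem_twist hy.2 hu.2
    rw [two] at h2
    rw [zero_add] at h1
    exact ⟨h1, h2⟩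
  have n1 : Y ≠ ⊥ ∨ W ≠ ⊥ := by
    by_contra! h
    refine hx' (cen x fun a => ?_)
    obtain ⟨b, c, d, e, hb, hc, hd, he, rfl⟩ := dec a
    rw [h.1, Submodule.mem_bot] at hc
    rw [h.2, Submodule.mem_bot] at he
    simp only [hc, he, add_zero, mul_add, add_mul, mem_twist_zero.1 hb.1, mem_twist_zero.1 hd.1]
  have n2 : U ≠ ⊥ ∨ W ≠ ⊥ := by
    by_contra! h
    refine hzF (cen z fun a => ?_)
    obtain ⟨b, c, d, e, hb, hc, hd, he, rfl⟩ := dec a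
    rw [h.1, Submodule.mem_bot] at hd
    rw [h.2, Submodule.mem_bot] at he
    simp only [hd, he, add_zero, mul_add, add_mul, mem_twist_zero.1 hb.2, mem_twist_zero.1 hc.2]
  have n3 : Y ≠ ⊥ ∨ U ≠ ⊥ := by
    by_contra! h
    refine hxzF (cen (x + z) fun a => ?_)
    obtain ⟨b, c, d, e, hb, hc, hd, he, rfl⟩ := dec a
    rw [h.2, Submodule.mem_bot] at hd
    rw [h.1, Submodule.mem_bot] at hc
    have h1 := mem_twist_one.1 he.1
    have h2 := mem_twist_one.1 he.2
    have h3 : (x + z) * e = e * (x + z) := by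
      rw [add_mul, h1, h2, add_add_add_comm, CharTwo.add_self_eq_zero, add_zero, mul_add]
    rw [hc, hd, add_zero, add_zero, mul_add, h3, add_mul, add_mul, mul_add,
      mem_twist_zero.1 hb.1, mem_twist_zero.1 hb.2, mul_add]
  simp only [Submodule.ne_bot_iff] at n1 n2 n3
  have fin : ∀ y u w, y ∈ Y → u ∈ U → w ∈ W → y ≠ 0 → u ≠ 0 → w ≠ 0 → ∃ y u w : A,
      y ≠ 0 ∧ u ≠ 0 ∧ w ≠ 0 ∧ y ∈ Y ∧ u ∈ U ∧ w ∈ W :=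
    fun y u w h1 h2 h3 h4 h5 h6 => ⟨y, u, w, h4, h5, h6, h1, h2, h3⟩
  rcases n1 with ⟨y, hy, hy0⟩ | ⟨w, hw, hw0⟩
  · rcases n2 with ⟨u, hu, hu0⟩ | ⟨w, hw, hw0⟩
    · exact fin y u _ hy hu (hYUW y hy u hu) hy0 hu0 (mul_ne_zero hy0 hu0)
    · exact fin y _ w hy (hYWU y hy w hw) hw hy0 (mul_ne_zero hy0 hw0) hw0
  · rcases n3 with ⟨y, hy, hy0⟩ | ⟨u, hu, hu0⟩
    · exact fin y _ w hy (hYWU y hy w hw) hw hy0 (mul_ne_zero hy0 hw0) hw0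
    · exact fin _ u w (hUWY u hu w hw) hu hw (mul_ne_zero hu0 hw0) hu0 hw0

theorem eq_zero_of_add_eq_zero {x z b c d e : A}
    (hb : b ∈ twist x x (0 : F) ⊓ twist z z (0 : F))
    (hc : c ∈ twist x x (1 : F) ⊓ twist z z (0 : F))
    (hd : d ∈ twist x x (0 : F) ⊓ twist z z (1 : F))
    (he : e ∈ twist x x (1 : F) ⊓ twist z z (1 : F)) (h : b + c + d + e = 0) :
    b = 0 ∧ c = 0 ∧ d = 0 ∧ e = 0 := by
  have hb1 := mem_twist_zero.1 hb.1
  have hc1 := mem_twist_one.1 hc.1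
  have hd1 := mem_twist_zero.1 hd.1
  have he1 := mem_twist_one.1 he.1
  have hb2 := mem_twist_zero.1 hb.2
  have hc2 := mem_twist_zero.1 hc.2
  have hd2 := mem_twist_one.1 hd.2
  have he2 := mem_twist_one.1 he.2
  have h1 : c + e = 0 := by
    have h3 : x * (b + c + d + e) = (b + c + d + e) * x + (c + e) := by
      simp only [mul_add, add_mul, hb1, hc1, hd1, he1]; abel
    rwa [h, mul_zero, zero_mul, zero_add, eq_comm] at h3
  have h2 : d + e = 0 := by
    have h3 : z * (b + c + d + e) = (b + c + d + e) * z + (d + e) := by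
      simp only [mul_add, add_mul, hb2, hc2, hd2, he2]; abel
    rwa [h, mul_zero, zero_mul, zero_add, eq_comm] at h3
  have h4 : e = 0 := by
    have h3 : z * (c + e) = (c + e) * z + e := by
      simp only [mul_add, add_mul, hc2, he2]; abel
    rwa [h1, mul_zero, zero_mul, zero_add, eq_comm] at h3
  subst h4
  simp_all

theorem linearIndependent_one_x_z_xz [CharP A 2] {x z : A} (hx : IsArtinSchreier F x)
    (hx' : x ∉ Set.range (algebraMap F A)) (hz' : z ∉ Algebra.adjoin F ({x} : Set A)) :
    LinearIndependent F ![1, x, z, x * z] := by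
  obtain ⟨α, hα⟩ := hx
  have key : ∀ a b : F, algebraMap F A a + b • x = 0 → a = 0 ∧ b = 0 := by
    intro a b h
    have hb : b = 0 := by
      by_contra hb
      refine hx' ⟨b⁻¹ * -a, ?_⟩
      have h1 : b • x = -algebraMap F A a := (neg_eq_of_add_eq_zero_right h).symm
      rw [map_mul, ← Algebra.smul_def, map_neg, ← h1, inv_smul_smul₀ hb]
    subst hb
    simpa using h
  rw [Fintype.linearIndependent_iff]
  intro g hg
  simp only [Fin.sum_univ_four, Matrix.cons_val] at hg
  set a := g 0
  set b := g 1
  set c := g 2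
  set d := g 3
  have hg' : (algebraMap F A a + b • x) + (algebraMap F A c + d • x) * z = 0 := by
    rw [← hg]
    simp only [add_mul, Algebra.algebraMap_eq_smul_one, smul_mul_assoc, one_mul]
    abel
  have hcd : algebraMap F A c + d • x = 0 := by
    by_contra h
    set p := algebraMap F A c + d • x with hp
    set q := algebraMap F A (c + d) + d • x with hq
    have hqp : q * p = algebraMap F A (c ^ 2 + c * d + d ^ 2 * α) := by
      have h1 : x * x = algebraMap F A α - x := by rw [hα, pow_two]; abel
      simp only [hp, hq, mul_add, add_mul, map_add, map_mul, smul_mul_assoc,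
        mul_smul_comm, h1, Algebra.algebraMap_eq_smul_one, one_mul, mul_one, smul_smul,
        pow_two, CharTwo.sub_eq_add, smul_add]
      have h2 := CharTwo.add_self_eq_zero ((d * c) • x)
      have h3 := CharTwo.add_self_eq_zero ((d * d) • x)
      rw [mul_comm c d] at *
      linear_combination (norm := module) h2 + h3
    set n := c ^ 2 + c * d + d ^ 2 * α
    have hn : n ≠ 0 := by
      intro hn
      rw [hn, map_zero, mul_eq_zero, or_iff_left h] at hqp
      obtain ⟨h1, h2⟩ := key _ _ hqp
      rw [h2, add_zero] at h1
      exact h (by simp [hp, h1, h2])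
    refine hz' ?_
    have hz : z = n⁻¹ • (q * -(algebraMap F A a + b • x)) := by
      rw [neg_eq_of_add_eq_zero_right hg', ← mul_assoc, hqp, ← Algebra.smul_def,
        inv_smul_smul₀ hn]
    have hxm := Algebra.self_mem_adjoin_singleton F x
    rw [hz]
    exact Subalgebra.smul_mem _ (mul_mem
      (add_mem (Subalgebra.algebraMap_mem _ _) (Subalgebra.smul_mem _ hxm _))
      (neg_mem (add_mem (Subalgebra.algebraMap_mem _ _) (Subalgebra.smul_mem _ hxm _)))) _
  rw [hcd, zero_mul, add_zero] at hg'
  obtain ⟨h0, h1⟩ := key _ _ hg'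
  obtain ⟨h2, h3⟩ := key _ _ hcd
  intro i
  fin_cases i <;> assumption

/-- The centralizer of two independent commuting Artin–Schreier elements is the algebra they
generate. -/
theorem exists_eq_of_mem_twist_zero [CharP A 2] (hcentral : Subalgebra.center F A = ⊥)
    (hdim : Module.finrank F A = 16)
    {x z : A} (hx : IsArtinSchreier F x) (hz : IsArtinSchreier F z) (hcomm : x * z = z * x)
    (hx' : x ∉ Set.range (algebraMap F A)) (hz' : z ∉ Algebra.adjoin F ({x} : Set A))
    {a : A} (ha : a ∈ twist x x (0 : F) ⊓ twist z z (0 : F)) :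
    ∃ c₀ c₁ c₂ c₃ : F, a = algebraMap F A c₀ + c₁ • x + c₂ • z + c₃ • (x * z) := by
  have hfin : FiniteDimensional F A := .of_finrank_pos (by omega)
  obtain ⟨y, u, w, hy0, hu0, hw0, hy, hu, hw⟩ :=
    exists_ne_zero_mem_twist hcentral hx hz hcomm hx' hz'
  set K := twist x x (0 : F) ⊓ twist z z (0 : F) with hK
  have hmul : ∀ {i j : F} {v : A}, v ∈ twist x x i ⊓ twist z z j → ∀ k ∈ K,
      k * v ∈ twist x x i ⊓ twist z z j := fun {i j v} hv k hk => by
    have h1 := mul_mem_twist hk.1 hv.1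
    have h2 := mul_mem_twist hk.2 hv.2
    rw [zero_add] at h1 h2
    exact ⟨h1, h2⟩
  let f : (K × K) × (K × K) →ₗ[F] A :=
    ((K.subtype).coprod (LinearMap.mulRight F y ∘ₗ K.subtype)).coprod
      ((LinearMap.mulRight F u ∘ₗ K.subtype).coprod (LinearMap.mulRight F w ∘ₗ K.subtype))
  have hf : Function.Injective f := by
    rw [injective_iff_map_eq_zero]
    rintro ⟨⟨⟨b, hb⟩, ⟨c, hc⟩⟩, ⟨⟨d, hd⟩, ⟨e, he⟩⟩⟩ h
    have h' : b + c * y + d * u + e * w = 0 := by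
      rw [← h]
      simp [f, add_assoc]
    obtain ⟨h1, h2, h3, h4⟩ := eq_zero_of_add_eq_zero hb (hmul hy c hc) (hmul hu d hd)
      (hmul hw e he) h'
    simp_all
  have hle := LinearMap.finrank_le_finrank_of_injective hf
  rw [hdim] at hle
  simp only [Module.finrank_prod] at hle
  have hli := linearIndependent_one_x_z_xz hx hx' hz'
  set L := Submodule.span F (Set.range ![1, x, z, x * z]) with hL
  have hLK : L ≤ K := by
    rw [hL, Submodule.span_le]
    rintro _ ⟨i, rfl⟩
    have hxz : x * (x * z) = x * z * x := by rw [mul_assoc, hcomm]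
    have hzx : z * (x * z) = x * z * z := by rw [← mul_assoc, hcomm]
    fin_cases i <;> simp [hK, mem_twist_zero, hcomm.symm, hxz, hzx]
  have hLr : Module.finrank F L = 4 := by
    rw [hL, finrank_span_eq_card hli, Fintype.card_fin]
  have hLK' : L = K := Submodule.eq_of_le_of_finrank_le hLK (by omega)
  rw [← hLK', hL, Submodule.mem_span_range_iff_exists_fun] at ha
  obtain ⟨c, hc⟩ := ha
  refine ⟨c 0, c 1, c 2, c 3, ?_⟩
  rw [← hc]
  simp [Fin.sum_univ_four, Algebra.algebraMap_eq_smul_one]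

end Twist

section Involution

open scoped TensorProduct Quaternion

variable {F : Type*} [Field F]

theorem QuaternionAlgebra.Basis.commute_liftHom {B : Type*} [Ring B] [Algebra F B] {a b c : F}
    (q : QuaternionAlgebra.Basis B a b c) {t : B} (hi : Commute t q.i) (hj : Commute t q.j)
    (p : ℍ[F,a,b,c]) : Commute t (q.liftHom p) := by
  have hk : Commute t q.k := q.i_mul_j ▸ hi.mul_right hj
  exact (((Algebra.commute_algebraMap_right p.re t).add_right (hi.smul_right _)).add_right
    (hj.smul_right _)).add_right (hk.smul_right _)

/-- Quadruples of generators in `B` define homomorphisms from a tensor product of quaternion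
algebras to `B`. -/
theorem exists_algHom_tensorProduct_quaternionAlgebra {B : Type*} [Ring B] [Algebra F B]
    {α β γ δ : F} {x y z u : B}
    (hx : x * x = α • (1 : B) + x) (hy : y * y = β • (1 : B))
    (hz : z * z = γ • (1 : B) + z) (hu : u * u = δ • (1 : B))
    (hxy : x * y + y * x = y) (hzu : z * u + u * z = u)
    (hxz : x * z = z * x) (hxu : x * u = u * x) (hyz : y * z = z * y) (hyu : y * u = u * y) :
    ∃ f : ℍ[F,α,1,β] ⊗[F] ℍ[F,γ,1,δ] →ₐ[F] B,
      f (⟨0, 1, 0, 0⟩ ⊗ₜ 1) = x ∧ f (⟨0, 0, 1, 0⟩ ⊗ₜ 1) = y ∧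
      f (1 ⊗ₜ ⟨0, 1, 0, 0⟩) = z ∧ f (1 ⊗ₜ ⟨0, 0, 1, 0⟩) = u := by
  let p : QuaternionAlgebra.Basis B α 1 β :=
    { i := x, j := y, k := x * y
      i_mul_i := by rw [hx, one_smul]
      j_mul_j := hy
      i_mul_j := rfl
      j_mul_i := by rw [one_smul, eq_sub_iff_add_eq, add_comm, hxy] }
  let q : QuaternionAlgebra.Basis B γ 1 δ :=
    { i := z, j := u, k := z * u
      i_mul_i := by rw [hz, one_smul]
      j_mul_j := hu
      i_mul_j := rfl
      j_mul_i := by rw [one_smul, eq_sub_iff_add_eq, add_comm, hzu] }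
  have hpq : ∀ a b, Commute (p.liftHom a) (q.liftHom b) := fun a b =>
    (p.commute_liftHom (q.commute_liftHom hxz hxu b).symm
      (q.commute_liftHom hyz hyu b).symm a).symm
  refine ⟨Algebra.TensorProduct.lift p.liftHom q.liftHom hpq, ?_, ?_, ?_, ?_⟩ <;>
  simp [QuaternionAlgebra.Basis.lift, p, q]

variable {A : Type*} [DivisionRing A] [Algebra F A]

theorem IsQuadruple.adjoin_eq_top [CharP A 2] (hcentral : Subalgebra.center F A = ⊥)
    (hdim : Module.finrank F A = 16) {x y z u : A} (h : IsQuadruple F (x, y, z, u)) :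
    Algebra.adjoin F ({x, y, z, u} : Set A) = ⊤ := by
  obtain ⟨hy0, hu0, hx, -, hz, -, hxy, hxz, hxu, hyz, hyu, hzu⟩ := h
  have hx' : x ∉ Set.range (algebraMap F A) := by
    rintro ⟨c, rfl⟩
    rw [Algebra.commutes, CharTwo.add_self_eq_zero] at hxy
    exact hy0 hxy.symm
  have hz' : z ∉ Algebra.adjoin F ({x} : Set A) := by
    intro hz
    have hle : Algebra.adjoin F ({x} : Set A) ≤ Subalgebra.centralizer F {u} := by
      rw [Algebra.adjoin_le_iff, Set.singleton_subset_iff]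
      exact (Subalgebra.mem_centralizer_iff F).2 (by simp [hxu])
    have := (Subalgebra.mem_centralizer_iff F).1 (hle hz) u rfl
    rw [this, CharTwo.add_self_eq_zero] at hzu
    exact hu0 hzu.symm
  set S := Algebra.adjoin F ({x, y, z, u} : Set A) with hS
  have hxS : x ∈ S := Algebra.subset_adjoin (by simp)
  have hyS : y ∈ S := Algebra.subset_adjoin (by simp)
  have hzS : z ∈ S := Algebra.subset_adjoin (by simp)
  have huS : u ∈ S := Algebra.subset_adjoin (by simp)
  have two : (1 : F) + 1 = 0 := by
    have : (algebraMap F A) (1 + 1) = 0 := by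
      rw [map_add, map_one, CharTwo.add_self_eq_zero]
    exact (map_eq_zero _).1 this
  have h0 : ∀ b ∈ twist x x (0 : F) ⊓ twist z z (0 : F), b ∈ S := by
    intro b hb
    obtain ⟨c₀, c₁, c₂, c₃, rfl⟩ :=
      exists_eq_of_mem_twist_zero hcentral hdim hx hz hxz hx' hz' hb
    exact add_mem (add_mem (add_mem (Subalgebra.algebraMap_mem _ _)
      (Subalgebra.smul_mem _ hxS _)) (Subalgebra.smul_mem _ hzS _))
      (Subalgebra.smul_mem _ (mul_mem hxS hzS) _)
  have h1 : ∀ {i j : F} {v b : A}, v ∈ twist x x i ⊓ twist z z j → v ≠ 0 → v ∈ S →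
      i + i = 0 → j + j = 0 → b ∈ twist x x i ⊓ twist z z j → b ∈ S := by
    intro i j v b hv hv0 hvS hi hj hb
    have m1 := mul_mem_twist hb.1 (inv_mem_twist hv.1)
    have m2 := mul_mem_twist hb.2 (inv_mem_twist hv.2)
    rw [hi] at m1
    rw [hj] at m2
    have := mul_mem (h0 _ ⟨m1, m2⟩) hvS
    rwa [inv_mul_cancel_right₀ hv0] at this
  have hyt : y ∈ twist x x (1 : F) ⊓ twist z z (0 : F) := by
    refine ⟨mem_twist_one.2 ?_, mem_twist_zero.2 hyz.symm⟩
    nth_rewrite 3 [← hxy]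
    rw [add_left_comm, CharTwo.add_self_eq_zero, add_zero]
  have hut : u ∈ twist x x (0 : F) ⊓ twist z z (1 : F) := by
    refine ⟨mem_twist_zero.2 hxu, mem_twist_one.2 ?_⟩
    nth_rewrite 3 [← hzu]
    rw [add_left_comm, CharTwo.add_self_eq_zero, add_zero]
  have hyut : y * u ∈ twist x x (1 : F) ⊓ twist z z (1 : F) := by
    have m1 := mul_mem_twist hyt.1 hut.1
    have m2 := mul_mem_twist hyt.2 hut.2
    rw [add_zero] at m1
    rw [zero_add] at m2
    exact ⟨m1, m2⟩
  obtain ⟨α, hα⟩ := hx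
  obtain ⟨β, hβ⟩ := hz
  refine Algebra.eq_top_iff.2 fun a => ?_
  obtain ⟨b, c, d, e, hb, hc, hd, he, rfl⟩ :=
    exists_twist_decomposition (F := F) hα.symm hα.symm hβ.symm hβ.symm
      (fun a => Algebra.commutes α a) (fun a => Algebra.commutes β a) hxz hxz a
  exact add_mem (add_mem (add_mem (h0 b hb) (h1 hyt hy0 hyS two (add_zero 0) hc))
    (h1 hut hu0 huS (add_zero 0) two hd))
    (h1 hyut (mul_ne_zero hy0 hu0) (mul_mem hyS huS) two two he)

/-- A biquaternion division algebra has an involution of the first kind. -/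
theorem IsQuadruple.exists_involution [CharP A 2] (hcentral : Subalgebra.center F A = ⊥)
    (hdim : Module.finrank F A = 16) {x y z u : A} (h : IsQuadruple F (x, y, z, u)) :
    ∃ σ : A →ₗ[F] A, σ 1 = 1 ∧ (∀ a b, σ (a * b) = σ b * σ a) ∧ ∀ a, σ (σ a) = a := by
  have htop := h.adjoin_eq_top hcentral hdim
  obtain ⟨-, -, ⟨α, hx⟩, ⟨β, hy⟩, ⟨γ, hz⟩, ⟨δ, hu⟩, hxy, hxz, hxu, hyz, hyu, hzu⟩ := h
  have hsq : ∀ {c : F} {t : A}, algebraMap F A c = t ^ 2 + t → t * t = c • (1 : A) + t := by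
    intro c t ht
    rw [← Algebra.algebraMap_eq_smul_one, ht, add_assoc, CharTwo.add_self_eq_zero, add_zero,
      pow_two]
  have hsq' : ∀ {c : F} {t : A}, algebraMap F A c = t ^ 2 → t * t = c • (1 : A) := by
    intro c t ht
    rw [← Algebra.algebraMap_eq_smul_one, ht, pow_two]
  obtain ⟨f, fx, fy, fz, fu⟩ := exists_algHom_tensorProduct_quaternionAlgebra
    (hsq hx) (hsq' hy) (hsq hz) (hsq' hu) hxy hzu hxz hxu hyz hyu
  open MulOpposite in
  obtain ⟨g, gx, gy, gz, gu⟩ := exists_algHom_tensorProduct_quaternionAlgebra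
    (α := α) (β := β) (γ := γ) (δ := δ) (x := op x) (y := op y) (z := op z) (u := op u)
    (congrArg op (hsq hx)) (congrArg op (hsq' hy)) (congrArg op (hsq hz)) (congrArg op (hsq' hu))
    (congrArg op ((add_comm _ _).trans hxy)) (congrArg op ((add_comm _ _).trans hzu))
    (congrArg op hxz.symm) (congrArg op hxu.symm) (congrArg op hyz.symm) (congrArg op hyu.symm)
  have hsurj : Function.Surjective f := by
    rw [← AlgHom.range_eq_top, eq_top_iff, ← htop, Algebra.adjoin_le_iff]
    rintro _ (rfl | rfl | rfl | rfl)
    exacts [⟨_, fx⟩, ⟨_, fy⟩, ⟨_, fz⟩, ⟨_, fu⟩]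
  have hfin : FiniteDimensional F A := .of_finrank_pos (by omega)
  have hinj : Function.Injective f := by
    refine (LinearMap.injective_iff_surjective_of_finrank_eq_finrank (f := f.toLinearMap) ?_).2
      hsurj
    rw [Module.finrank_tensorProduct, QuaternionAlgebra.finrank_eq_four,
      QuaternionAlgebra.finrank_eq_four, hdim]
  let e := AlgEquiv.ofBijective f ⟨hinj, hsurj⟩
  let s : A →ₐ[F] Aᵐᵒᵖ := g.comp e.symm.toAlgHom
  have hs : ∀ {t a}, f t = a → s a = g t := by
    rintro t _ rfl
    exact congrArg g (e.symm_apply_apply t)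
  let σ : A →ₗ[F] A := (MulOpposite.opLinearEquiv F).symm.toLinearMap ∘ₗ s.toLinearMap
  have hσ1 : σ 1 = 1 := by simp [σ]
  have hσm : ∀ a b, σ (a * b) = σ b * σ a := fun a b => by simp [σ]
  refine ⟨σ, hσ1, hσm, fun a => ?_⟩
  have hσ : ∀ {t a b}, f t = a → g t = MulOpposite.op b → σ a = b := fun {t a b} h1 h2 => by
    simp [σ, hs h1, h2]
  have hid : AlgHom.ofLinearMap (σ ∘ₗ σ) (by simp [hσ1]) (by simp [hσm]) = AlgHom.id F A := by
    refine AlgHom.ext_of_adjoin_eq_top htop ?_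
    rintro _ (rfl | rfl | rfl | rfl)
    · simp [hσ fx gx]
    · simp [hσ fy gy]
    · simp [hσ fz gz]
    · simp [hσ fu gu]
  exact DFunLike.congr_fun hid a

end Involution

section Symmetric

variable {F A : Type*} [Field F] [DivisionRing A] [Algebra F A]

theorem exists_fixed_of_mem [CharP A 2] (τ : A →ₗ[F] A) (hτ : ∀ a, τ (τ a) = a)
    {V : Submodule F A} (hV : ∀ v ∈ V, τ v ∈ V) {v : A} (hv : v ∈ V) (hv0 : v ≠ 0) :
    ∃ w ∈ V, w ≠ 0 ∧ τ w = w := by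
  by_cases h : v + τ v = 0
  · exact ⟨v, hv, hv0, (CharTwo.add_eq_zero.1 h).symm⟩
  · exact ⟨v + τ v, add_mem hv (hV v hv), h, by rw [map_add, hτ, add_comm]⟩

theorem map_mem_twist [CharP A 2] (τ : A →ₗ[F] A) (hm : ∀ a b, τ (a * b) = τ b * τ a)
    {x' x v : A} {i : F} (h : v ∈ twist x' x i) : τ v ∈ twist (τ x) (τ x') i := by
  rw [mem_twist] at *
  have := congrArg τ h
  rw [hm, map_add, hm, map_smul] at this
  rw [this, add_assoc, CharTwo.add_self_eq_zero, add_zero]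

/-- Two commuting Artin–Schreier elements are fixed by some involution of the first kind. -/
theorem exists_involution_fixing [CharP A 2] (hcentral : Subalgebra.center F A = ⊥)
    (σ : A →ₗ[F] A) (h1 : σ 1 = 1) (hm : ∀ a b, σ (a * b) = σ b * σ a) (hσ : ∀ a, σ (σ a) = a)
    {x z : A} (hx : IsArtinSchreier F x) (hz : IsArtinSchreier F z) (hcomm : x * z = z * x)
    (hx' : x ∉ Set.range (algebraMap F A)) (hz' : z ∉ Algebra.adjoin F ({x} : Set A)) :
    ∃ τ : A →ₗ[F] A, (∀ a b, τ (a * b) = τ b * τ a) ∧ (∀ a, τ (τ a) = a) ∧ τ x = x ∧ τ z = z := by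
  obtain ⟨y, u, w, hy0, hu0, hw0, hy, hu, hw⟩ :=
    exists_ne_zero_mem_twist hcentral hx hz hcomm hx' hz'
  obtain ⟨α, hα⟩ := hx
  obtain ⟨β, hβ⟩ := hz
  have two : (1 : F) + 1 = 0 := by
    have : (algebraMap F A) (1 + 1) = 0 := by
      rw [map_add, map_one, CharTwo.add_self_eq_zero]
    exact (map_eq_zero _).1 this
  have hσAS : ∀ {c : F} {t : A}, algebraMap F A c = t ^ 2 + t →
      σ t ^ 2 + σ t = algebraMap F A c := by
    intro c t h
    have := congrArg σ h
    rw [Algebra.algebraMap_eq_smul_one, map_smul, h1, map_add, pow_two, hm] at this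
    rw [Algebra.algebraMap_eq_smul_one, this, pow_two]
  have hex : ∃ v ∈ twist (σ x) x (0 : F) ⊓ twist (σ z) z (0 : F), v ≠ 0 := by
    obtain ⟨b, c, d, e, hb, hc, hd, he, hs⟩ :=
      exists_twist_decomposition (F := F) (hσAS hα) hα.symm (hσAS hβ) hβ.symm
        (fun a => Algebra.commutes α a) (fun a => Algebra.commutes β a)
        (by rw [← hm, ← hm, hcomm]) hcomm (1 : A)
    have hmul : ∀ {i j : F} {v k : A}, v ∈ twist x x i ⊓ twist z z j →
        k ∈ twist (σ x) x i ⊓ twist (σ z) z j → i + i = 0 → j + j = 0 →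
        k * v ∈ twist (σ x) x (0 : F) ⊓ twist (σ z) z (0 : F) := by
      intro i j v k hv hk hi hj
      have m1 := mul_mem_twist hk.1 hv.1
      have m2 := mul_mem_twist hk.2 hv.2
      rw [hi] at m1
      rw [hj] at m2
      exact ⟨m1, m2⟩
    by_cases hb0 : b = 0
    · by_cases hc0 : c = 0
      · by_cases hd0 : d = 0
        · have he0 : e ≠ 0 := by
            rintro rfl
            simp [hb0, hc0, hd0] at hs
          exact ⟨_, hmul hw he two two, mul_ne_zero he0 hw0⟩
        · exact ⟨_, hmul hu hd (add_zero 0) two, mul_ne_zero hd0 hu0⟩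
      · exact ⟨_, hmul hy hc two (add_zero 0), mul_ne_zero hc0 hy0⟩
    · exact ⟨b, hb, hb0⟩
  obtain ⟨v, hv, hv0⟩ := hex
  obtain ⟨g, hg, hg0, hσg⟩ := exists_fixed_of_mem σ hσ (fun v hv => by
    have m1 := map_mem_twist σ hm hv.1
    have m2 := map_mem_twist σ hm hv.2
    rw [hσ] at m1 m2
    exact ⟨m1, m2⟩) hv hv0
  have hσg' : σ g⁻¹ = g⁻¹ := by
    refine eq_inv_of_mul_eq_one_right ?_
    nth_rewrite 1 [← hσg]
    rw [← hm, inv_mul_cancel₀ hg0, h1]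
  refine ⟨LinearMap.mulLeft F g⁻¹ ∘ₗ LinearMap.mulRight F g ∘ₗ σ, fun a b => ?_, fun a => ?_,
    ?_, ?_⟩
  · simp [hm, mul_assoc, hg0]
  · simp [hm, mul_assoc, hg0, hσ, hσg, hσg']
  · simp [mem_twist_zero.1 hg.1, hg0]
  · simp [mem_twist_zero.1 hg.2, hg0]

end Symmetric

theorem exists_quadruple_of_commuting_artinSchreier (F A : Type*) [Field F] [CharP F 2]
    [DivisionRing A] [Algebra F A]
    (hcentral : Subalgebra.center F A = ⊥) (hdim : Module.finrank F A = 16)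
    (hbiquat : ∃ q : A × A × A × A, IsQuadruple F q)
    (x z : A) (hx : IsArtinSchreier F x) (hz : IsArtinSchreier F z)
    (hcomm : x * z = z * x)
    (hx' : x ∉ Set.range (algebraMap F A))
    (hz' : z ∉ Algebra.adjoin F ({x} : Set A)) :
    ∃ y u : A, IsSquareCentral F y ∧ IsSquareCentral F u ∧ IsQuadruple F (x, y, z, u) := by
  have hchar : CharP A 2 := charP_of_injective_algebraMap (algebraMap F A).injective 2
  have two : (1 : F) + 1 = 0 := CharTwo.add_self_eq_zero 1
  obtain ⟨⟨x₀, y₀, z₀, u₀⟩, hq⟩ := hbiquat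
  obtain ⟨σ, h1, hm, hσ⟩ := hq.exists_involution hcentral hdim
  obtain ⟨τ, hm, hτ, hτx, hτz⟩ :=
    exists_involution_fixing hcentral σ h1 hm hσ hx hz hcomm hx' hz'
  have hstable : ∀ {i j : F}, ∀ v ∈ twist x x i ⊓ twist z z j,
      τ v ∈ twist x x i ⊓ twist z z j := fun {i j} v hv => by
    have m1 := map_mem_twist τ hm hv.1
    have m2 := map_mem_twist τ hm hv.2
    rw [hτx] at m1
    rw [hτz] at m2
    exact ⟨m1, m2⟩
  have hmul : ∀ {i j i' j' : F} {a b : A}, a ∈ twist x x i ⊓ twist z z j →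
      b ∈ twist x x i' ⊓ twist z z j' → a * b ∈ twist x x (i + i') ⊓ twist z z (j + j') :=
    fun ha hb => ⟨mul_mem_twist ha.1 hb.1, mul_mem_twist ha.2 hb.2⟩
  have hinv : ∀ {i j : F} {a : A}, a ∈ twist x x i ⊓ twist z z j →
      a⁻¹ ∈ twist x x i ⊓ twist z z j := fun ha => ⟨inv_mem_twist ha.1, inv_mem_twist ha.2⟩
  obtain ⟨y₁, u₁, w₁, hy₁, hu₁, hw₁, hy₁', hu₁', hw₁'⟩ :=
    exists_ne_zero_mem_twist hcentral hx hz hcomm hx' hz'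
  obtain ⟨y, hy, hy0, hτy⟩ := exists_fixed_of_mem τ hτ hstable hy₁' hy₁
  obtain ⟨u, hu, hu0, hτu⟩ := exists_fixed_of_mem τ hτ hstable hu₁' hu₁
  obtain ⟨w, hw, hw0, hτw⟩ := exists_fixed_of_mem τ hτ hstable hw₁' hw₁
  have hK := fun a ha => exists_eq_of_mem_twist_zero hcentral hdim hx hz hcomm hx' hz' (a := a) ha
  have hτK : ∀ a ∈ twist x x (0 : F) ⊓ twist z z (0 : F), τ a = a := by
    intro a ha
    obtain ⟨c₀, c₁, c₂, c₃, rfl⟩ := hK a ha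
    have hτ1 : τ 1 = 1 := by
      have := hm 1 (τ 1)
      rwa [one_mul, hτ, one_mul, eq_comm] at this
    simp only [map_add, map_smul, hm, hτx, hτz, hcomm, Algebra.algebraMap_eq_smul_one, hτ1]
  set d := w * (y * u)⁻¹ with hd
  have hdK : τ d = d := by
    refine hτK d ?_
    have := hmul hw (hinv (hmul hy hu))
    rwa [add_zero, zero_add, two] at this
  have hw1 : d * (y * u) = w := inv_mul_cancel_right₀ (mul_ne_zero hy0 hu0) w
  have hw2 : u * y * d = w := by
    have := congrArg τ hw1
    rwa [hm, hm, hτy, hτu, hdK, hτw] at this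
  have hwc : w * (y * u) = u * y * w := by
    nth_rewrite 1 [← hw2]
    rw [mul_assoc (u * y), hw1]
  set y' := w * u⁻¹ with hy'
  set u' := u * y * u * w⁻¹ with hu'
  have hy'0 : y' ≠ 0 := mul_ne_zero hw0 (inv_ne_zero hu0)
  have hu'0 : u' ≠ 0 :=
    mul_ne_zero (mul_ne_zero (mul_ne_zero hu0 hy0) hu0) (inv_ne_zero hw0)
  have hy't : y' ∈ twist x x (1 : F) ⊓ twist z z (0 : F) := by
    have := hmul hw (hinv hu)
    rwa [add_zero, two] at this
  have hu't : u' ∈ twist x x (0 : F) ⊓ twist z z (1 : F) := by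
    have := hmul (hmul (hmul hu hy) hu) (hinv hw)
    simpa only [add_zero, zero_add, two] using this
  have hyu : y' * u' = u' * y' := by
    have e1 : y' * u' = w * (y * u) * w⁻¹ := by
      simp [hy', hu', mul_assoc, hu0]
    have e2 : u' * y' = u * y := by
      simp [hy', hu', mul_assoc, hu0, hw0]
    rw [e1, e2, hwc, mul_inv_cancel_right₀ hw0]
  have hzF : z ∉ Set.range (algebraMap F A) := by
    rintro ⟨c, rfl⟩
    exact hz' (Subalgebra.algebraMap_mem _ c)
  have hF : ∀ a ∈ twist x x (0 : F) ⊓ twist z z (0 : F), a * y' = y' * a → a * u' = u' * a →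
      a ∈ Set.range (algebraMap F A) := by
    intro a ha hay hau
    obtain ⟨c₀, c₁, c₂, c₃, rfl⟩ := hK a ha
    have hxy := mem_twist_one.1 hy't.1
    have hzy := mem_twist_zero.1 hy't.2
    have hxu := mem_twist_zero.1 hu't.1
    have hzu := mem_twist_one.1 hu't.2
    have e1 : (algebraMap F A c₁ + c₃ • z) * y' = 0 := by
      have : (algebraMap F A c₀ + c₁ • x + c₂ • z + c₃ • (x * z)) * y' =
          y' * (algebraMap F A c₀ + c₁ • x + c₂ • z + c₃ • (x * z)) +
          (algebraMap F A c₁ + c₃ • z) * y' := by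
        simp only [add_mul, mul_add, smul_mul_assoc, mul_smul_comm, mul_assoc, hzy,
          Algebra.algebraMap_eq_smul_one, one_mul, mul_one]
        simp only [← mul_assoc, hxy, add_mul, smul_add]
        abel
      rwa [hay, left_eq_add] at this
    have e2 := (mul_eq_zero.1 e1).resolve_right hy'0
    have hc₃ : c₃ = 0 := by
      by_contra h
      refine hzF ⟨c₃⁻¹ * -c₁, ?_⟩
      rw [map_mul, ← Algebra.smul_def, map_neg, neg_eq_of_add_eq_zero_right e2,
        inv_smul_smul₀ h]
    have hc₁ : c₁ = 0 := by simpa [hc₃] using e2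
    subst hc₃ hc₁
    have e3 : c₂ • u' = 0 := by
      simpa [add_mul, mul_add, Algebra.commutes, hzu] using hau
    have hc₂ : c₂ = 0 := (smul_eq_zero.1 e3).resolve_right hu'0
    exact ⟨c₀, by simp [hc₂]⟩
  have hy'sq : IsSquareCentral F y' := by
    refine hF _ ?_ ?_ ?_
    · have := hmul hy't hy't
      rwa [two, add_zero, ← pow_two] at this
    · rw [← pow_succ, ← pow_succ']
    · exact (Commute.pow_left hyu 2).eq
  have hu'sq : IsSquareCentral F u' := by
    refine hF _ ?_ ?_ ?_
    · have := hmul hu't hu't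
      rwa [two, add_zero, ← pow_two] at this
    · exact (Commute.pow_left (show Commute u' y' from hyu.symm) 2).eq
    · rw [← pow_succ, ← pow_succ']
  have hone : ∀ {s v : A}, v ∈ twist s s (1 : F) → s * v + v * s = v := fun h => by
    rw [mem_twist_one.1 h, add_right_comm, CharTwo.add_self_eq_zero, zero_add]
  exact ⟨y', u', hy'sq, hu'sq, hy'0, hu'0, hx, hy'sq, hz, hu'sq, hone hy't.1, hcomm,
    mem_twist_zero.1 hu't.1, (mem_twist_zero.1 hy't.2).symm, hyu, hone hu't.2⟩
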